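/- arXiv:2510.25104 — 3 statements merged into one kernel-verified Lean document; each statement's English description precedes it below -/
import Mathlib

section
/- For every nonnegative integer n, F_1(n) = (p̄(n) - p̄_o(n))/2, where F_1(n) counts the partitions counted by F(n) having an odd number of even parts. -/
noncomputable section

/-- Overpartitions of `n`: the first component is the set of overlined parts
(at most one overlined part of each size), the second is the multiset of
non-overlined parts; all parts are positive and the total sum is `n`. -/
def overpartitions (n : ℕ) : Set (Finset ℕ × Multiset ℕ) :=
  {p | (∀ x ∈ p.1, 0 < x) ∧ (∀ x ∈ p.2, 0 < x) ∧ p.1.sum id + p.2.sum = n}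

/-- `p̄(n)`, the number of overpartitions of `n`. -/
def pbar (n : ℕ) : ℕ := (overpartitions n).ncard

/-- Overpartitions of `n` into odd parts. -/
def overpartitionsOdd (n : ℕ) : Set (Finset ℕ × Multiset ℕ) :=
  {p | p ∈ overpartitions n ∧ (∀ x ∈ p.1, Odd x) ∧ ∀ x ∈ p.2, Odd x}

/-- `p̄_o(n)`, the number of overpartitions of `n` into odd parts. -/
def pbarOdd (n : ℕ) : ℕ := (overpartitionsOdd n).ncard

/-- Two-color partitions of `n` (first component: blue parts, second: green
parts) in which even parts may occur only in the blue color, i.e. all green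
parts are odd. -/
def FSet (n : ℕ) : Set (Multiset ℕ × Multiset ℕ) :=
  {p | (∀ x ∈ p.1, 0 < x) ∧ (∀ x ∈ p.2, 0 < x) ∧ p.1.sum + p.2.sum = n ∧
    ∀ x ∈ p.2, Odd x}

/-- `F(n)`. -/
def Fcount (n : ℕ) : ℕ := (FSet n).ncard

/-- The number of even parts of a multiset of naturals. -/
def evenParts (m : Multiset ℕ) : ℕ := Multiset.card (m.filter (fun x => Even x))

/-- `F₀(n)`: partitions counted by `F(n)` with an even number of even parts. -/
def F0 (n : ℕ) : ℕ := {p ∈ FSet n | Even (evenParts (p.1 + p.2))}.ncard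

/-- `F₁(n)`: partitions counted by `F(n)` with an odd number of even parts. -/
def F1 (n : ℕ) : ℕ := {p ∈ FSet n | Odd (evenParts (p.1 + p.2))}.ncard

/-- `F₂(n)`: partitions counted by `F(n)` with an even number of parts. -/
def F2 (n : ℕ) : ℕ := {p ∈ FSet n | Even (Multiset.card (p.1 + p.2))}.ncard

/-- `F₃(n)`: partitions counted by `F(n)` with an odd number of parts. -/
def F3 (n : ℕ) : ℕ := {p ∈ FSet n | Odd (Multiset.card (p.1 + p.2))}.ncard

/-- Partitions counted by `F(n)` whose blue parts are distinct odd numbers. -/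
def QSet (n : ℕ) : Set (Multiset ℕ × Multiset ℕ) :=
  {p | p ∈ FSet n ∧ (∀ x ∈ p.1, Odd x) ∧ p.1.Nodup}

/-- `Q(n)`. -/
def Qcount (n : ℕ) : ℕ := (QSet n).ncard

/-- Two-color partitions of `n` (first component: blue parts, second: green
parts) in which odd parts may occur only in the blue color, i.e. all green
parts are even. -/
def GSet (n : ℕ) : Set (Multiset ℕ × Multiset ℕ) :=
  {p | (∀ x ∈ p.1, 0 < x) ∧ (∀ x ∈ p.2, 0 < x) ∧ p.1.sum + p.2.sum = n ∧
    ∀ x ∈ p.2, Even x}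

/-- `G(n)`. -/
def Gcount (n : ℕ) : ℕ := (GSet n).ncard

/-- `G₀(n)`: partitions counted by `G(n)` with an even number of blue even parts. -/
def G0 (n : ℕ) : ℕ := {p ∈ GSet n | Even (evenParts p.1)}.ncard

/-- `G₁(n)`: partitions counted by `G(n)` with an odd number of blue even parts. -/
def G1 (n : ℕ) : ℕ := {p ∈ GSet n | Odd (evenParts p.1)}.ncard

/-- `G₂(n)`: partitions counted by `G(n)` with an even number of blue parts. -/
def G2 (n : ℕ) : ℕ := {p ∈ GSet n | Even (Multiset.card p.1)}.ncard

/-- `G₃(n)`: partitions counted by `G(n)` with an odd number of blue parts. -/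
def G3 (n : ℕ) : ℕ := {p ∈ GSet n | Odd (Multiset.card p.1)}.ncard

/-- `G₄(n)`: partitions counted by `G(n)` with an even total number of parts. -/
def G4 (n : ℕ) : ℕ := {p ∈ GSet n | Even (Multiset.card (p.1 + p.2))}.ncard

/-- `G₅(n)`: partitions counted by `G(n)` with an odd total number of parts. -/
def G5 (n : ℕ) : ℕ := {p ∈ GSet n | Odd (Multiset.card (p.1 + p.2))}.ncard

/-- Partitions of `n` in which the odd parts are distinct. -/
def HSet (n : ℕ) : Set (Multiset ℕ) :=
  {m | (∀ x ∈ m, 0 < x) ∧ m.sum = n ∧ (m.filter (fun x => Odd x)).Nodup}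

/-- `H(n)`. -/
def Hcount (n : ℕ) : ℕ := (HSet n).ncard

/-- Partitions of `n` into distinct parts whose even parts are all
congruent to `2` modulo `4`. -/
def KSet (n : ℕ) : Set (Finset ℕ) :=
  {s | (∀ x ∈ s, 0 < x) ∧ s.sum id = n ∧ ∀ x ∈ s, Even x → x % 4 = 2}

/-- `K(n)`: the signed count of partitions in `KSet n`, each weighted by
`(-1)^j` where `j` is the number of even parts. -/
def Kcount (n : ℕ) : ℤ :=
  ({s ∈ KSet n | Even (s.filter (fun x => Even x)).card}.ncard : ℤ) -
  ({s ∈ KSet n | Odd (s.filter (fun x => Even x)).card}.ncard : ℤ)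

/-- Partitions counted by `G(n)` whose blue parts are distinct odd numbers. -/
def RSet (n : ℕ) : Set (Multiset ℕ × Multiset ℕ) :=
  {p | p ∈ GSet n ∧ (∀ x ∈ p.1, Odd x) ∧ p.1.Nodup}

/-- `R(n)`. -/
def Rcount (n : ℕ) : ℕ := (RSet n).ncard

/-- Two-color partitions of `n` in which all parts of the same color are
distinct and odd parts may occur only in the blue color: the first component
is the (finite) set of blue parts (distinct positive integers), the second the
set of green parts (distinct positive even integers). -/
def LSet (n : ℕ) : Set (Finset ℕ × Finset ℕ) :=
  {p | (∀ x ∈ p.1, 0 < x) ∧ (∀ x ∈ p.2, 0 < x ∧ Even x) ∧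
    p.1.sum id + p.2.sum id = n}

/-- `L₀(n)`: partitions counted by `L(n)` with an even number of blue even parts. -/
def L0 (n : ℕ) : ℕ := {p ∈ LSet n | Even (p.1.filter (fun x => Even x)).card}.ncard

/-- `L₁(n)`: partitions counted by `L(n)` with an odd number of blue even parts. -/
def L1 (n : ℕ) : ℕ := {p ∈ LSet n | Odd (p.1.filter (fun x => Even x)).card}.ncard

/-- `L₂(n)`: partitions counted by `L(n)` with an even number of blue parts. -/
def L2 (n : ℕ) : ℕ := {p ∈ LSet n | Even p.1.card}.ncard

/-- `L₃(n)`: partitions counted by `L(n)` with an odd number of blue parts. -/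
def L3 (n : ℕ) : ℕ := {p ∈ LSet n | Odd p.1.card}.ncard

/-- largest repeated part -/
def maxRep (m : Multiset ℕ) : ℕ := (m.toFinset.filter (fun y => 2 ≤ m.count y)).sup id

/-- largest even part -/
def maxEven (m : Multiset ℕ) : ℕ := (m.toFinset.filter (fun y => Even y)).sup id

lemma le_maxRep {m : Multiset ℕ} {y : ℕ} (h : 2 ≤ m.count y) : y ≤ maxRep m := by
  have : y ∈ m.toFinset.filter (fun y => 2 ≤ m.count y) := by
    rw [Finset.mem_filter, Multiset.mem_toFinset]
    exact ⟨Multiset.count_pos.1 (by omega), h⟩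
  exact Finset.le_sup (f := id) this

lemma le_maxEven {m : Multiset ℕ} {y : ℕ} (h : y ∈ m) (h2 : Even y) : y ≤ maxEven m := by
  have : y ∈ m.toFinset.filter (fun y => Even y) := by
    rw [Finset.mem_filter, Multiset.mem_toFinset]
    exact ⟨h, h2⟩
  exact Finset.le_sup (f := id) this

lemma maxRep_eq {m : Multiset ℕ} {x : ℕ} (h : 2 ≤ m.count x)
    (h' : ∀ y, 2 ≤ m.count y → y ≤ x) : maxRep m = x := by
  refine le_antisymm (Finset.sup_le ?_) (le_maxRep h)
  intro y hy
  exact h' y (Finset.mem_filter.1 hy).2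

lemma maxEven_eq {m : Multiset ℕ} {x : ℕ} (h : x ∈ m) (h2 : Even x)
    (h' : ∀ y ∈ m, Even y → y ≤ x) : maxEven m = x := by
  refine le_antisymm (Finset.sup_le ?_) (le_maxEven h h2)
  intro y hy
  rw [Finset.mem_filter, Multiset.mem_toFinset] at hy
  exact h' y hy.1 hy.2

lemma maxRep_spec {m : Multiset ℕ} (h : 0 < maxRep m) : 2 ≤ m.count (maxRep m) := by
  have hne : (m.toFinset.filter (fun y => 2 ≤ m.count y)).Nonempty := by
    by_contra hc
    rw [Finset.not_nonempty_iff_eq_empty] at hc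
    simp [maxRep, hc] at h
  obtain ⟨y, hy, hy'⟩ := Finset.exists_mem_eq_sup _ hne id
  have : maxRep m = y := hy'
  rw [this]
  exact (Finset.mem_filter.1 hy).2

lemma maxEven_spec {m : Multiset ℕ} (h : 0 < maxEven m) :
    maxEven m ∈ m ∧ Even (maxEven m) := by
  have hne : (m.toFinset.filter (fun y => Even y)).Nonempty := by
    by_contra hc
    rw [Finset.not_nonempty_iff_eq_empty] at hc
    simp [maxEven, hc] at h
  obtain ⟨y, hy, hy'⟩ := Finset.exists_mem_eq_sup _ hne id
  have : maxEven m = y := hy'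
  rw [this]
  rw [Finset.mem_filter, Multiset.mem_toFinset] at hy
  exact hy

/-- the sign-reversing involution -/
def inv (m : Multiset ℕ) : Multiset ℕ :=
  if 2 * maxRep m ≤ maxEven m then
    (maxEven m / 2) ::ₘ (maxEven m / 2) ::ₘ m.erase (maxEven m)
  else (2 * maxRep m) ::ₘ (m.erase (maxRep m)).erase (maxRep m)

/-- The two situations. -/
lemma inv_cases (m : Multiset ℕ) (hpos : ∀ x ∈ m, 0 < x)
    (hq : ¬ ((∀ x ∈ m, Odd x) ∧ m.Nodup)) :
    ∃ x t, 0 < x ∧ inv (2 * x ::ₘ t) = x ::ₘ x ::ₘ t ∧ inv (x ::ₘ x ::ₘ t) = 2 * x ::ₘ t ∧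
      (m = 2 * x ::ₘ t ∨ m = x ::ₘ x ::ₘ t) := by
  -- a general computation
  have key : ∀ (x : ℕ) (t : Multiset ℕ), 0 < x → (∀ y ∈ t, Even y → y < 2 * x) →
      (∀ y, 2 ≤ t.count y → y ≤ x) → 
      inv (2 * x ::ₘ t) = x ::ₘ x ::ₘ t ∧ inv (x ::ₘ x ::ₘ t) = 2 * x ::ₘ t := by
    intro x t hx he hr
    have hnot : 2 * x ∉ t := fun h => by have := he _ h (even_two_mul x); omega
    have e1 : maxEven (2 * x ::ₘ t) = 2 * x := by
      apply maxEven_eq (by simp) (even_two_mul x)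
      intro y hy hy2
      rcases Multiset.mem_cons.1 hy with h | h
      · omega
      · exact (he y h hy2).le
    have r1 : maxRep (2 * x ::ₘ t) ≤ x := by
      rcases Nat.eq_zero_or_pos (maxRep (2 * x ::ₘ t)) with h | h
      · omega
      · have := maxRep_spec h
        by_cases hh : maxRep (2 * x ::ₘ t) = 2 * x
        · rw [hh, Multiset.count_cons_self, Multiset.count_eq_zero_of_notMem hnot] at this
          omega
        · rw [Multiset.count_cons_of_ne hh] at this
          exact hr _ this
    have r2 : maxRep (x ::ₘ x ::ₘ t) = x := by
      apply maxRep_eq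
      · simp
      · intro y hy
        by_cases hh : y = x
        · omega
        · rw [Multiset.count_cons_of_ne hh, Multiset.count_cons_of_ne hh] at hy
          exact hr _ hy
    have e2 : maxEven (x ::ₘ x ::ₘ t) < 2 * x := by
      rcases Nat.eq_zero_or_pos (maxEven (x ::ₘ x ::ₘ t)) with h | h
      · omega
      · obtain ⟨h1, h2⟩ := maxEven_spec h
        rcases Multiset.mem_cons.1 h1 with h | h
        · omega
        rcases Multiset.mem_cons.1 h with h | h
        · omega
        exact he _ h h2
    constructor
    · rw [inv, if_pos (by omega), e1]
      simp
    · rw [inv, if_neg (by omega), r2]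
      simp
  by_cases hc : 2 * maxRep m ≤ maxEven m
  · have hpos' : 0 < maxEven m := by
      by_contra h0
      apply hq
      constructor
      · intro x hx
        by_contra hodd
        have := le_maxEven hx (Nat.not_odd_iff_even.1 hodd)
        have := hpos x hx
        omega
      · rw [Multiset.nodup_iff_count_le_one]
        intro a
        by_contra ha
        have h1 := le_maxRep (m := m) (y := a) (by omega)
        have := hpos a (Multiset.count_pos.1 (by omega))
        omega
    obtain ⟨h1, h2⟩ := maxEven_spec hpos'
    obtain ⟨x, hx⟩ := h2
    have hx : maxEven m = 2 * x := by omega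
    rw [hx] at h1
    obtain ⟨t, rfl⟩ := Multiset.exists_cons_of_mem h1
    have := key x t (by omega) ?_ ?_
    · exact ⟨x, t, by omega, this.1, this.2, Or.inl rfl⟩
    · intro y hy hy2
      have h3 := le_maxEven (m := 2 * x ::ₘ t) (y := y) (by simp [hy]) hy2
      refine lt_of_le_of_ne (by omega) ?_
      rintro rfl
      have := le_maxRep (m := 2 * x ::ₘ t) (y := 2 * x) (by
        rw [Multiset.count_cons_self]; have := Multiset.count_pos.2 hy; omega)
      omega
    · intro y hy
      have := le_maxRep (m := 2 * x ::ₘ t) (y := y)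
        (hy.trans (Multiset.count_le_count_cons _ _ _))
      omega
  · have h1 := maxRep_spec (m := m) (by omega)
    obtain ⟨x, hx⟩ : ∃ x, x = maxRep m := ⟨_, rfl⟩
    rw [← hx] at h1 hc
    obtain ⟨s, rfl⟩ := Multiset.exists_cons_of_mem (Multiset.count_pos.1 (by omega : 0 < m.count x))
    rw [Multiset.count_cons_self] at h1
    obtain ⟨t, rfl⟩ := Multiset.exists_cons_of_mem (Multiset.count_pos.1 (by omega : 0 < s.count x))
    have := key x t (by omega) ?_ ?_
    · exact ⟨x, t, by omega, this.1, this.2, Or.inr rfl⟩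
    · intro y hy hy2
      have h3 := le_maxEven (m := x ::ₘ x ::ₘ t) (y := y) (by simp [hy]) hy2
      omega
    · intro y hy
      have := le_maxRep (m := x ::ₘ x ::ₘ t) (y := y)
        (hy.trans ((Multiset.count_le_count_cons _ _ _).trans (Multiset.count_le_count_cons _ _ _)))
      omega

lemma evenParts_cons_even (x : ℕ) (t : Multiset ℕ) :
    evenParts (2 * x ::ₘ t) = evenParts t + 1 := by
  simp [evenParts]

lemma evenParts_cons_cons (x : ℕ) (t : Multiset ℕ) :
    (-1 : ℤ) ^ evenParts (x ::ₘ x ::ₘ t) = (-1) ^ evenParts t := by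
  by_cases h : Even x <;> simp [evenParts, h, pow_succ]

lemma inv_props (m : Multiset ℕ) (hpos : ∀ x ∈ m, 0 < x)
    (hq : ¬ ((∀ x ∈ m, Odd x) ∧ m.Nodup)) :
    inv (inv m) = m ∧ (∀ x ∈ inv m, 0 < x) ∧ (inv m).sum = m.sum ∧
    ¬ ((∀ x ∈ inv m, Odd x) ∧ (inv m).Nodup) ∧
    (-1 : ℤ) ^ evenParts m + (-1) ^ evenParts (inv m) = 0 := by
  obtain ⟨x, t, hx, h1, h2, rfl | rfl⟩ := inv_cases m hpos hq
  · rw [h1, h2, evenParts_cons_even, evenParts_cons_cons]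
    refine ⟨rfl, ?_, ?_, ?_, ?_⟩
    · intro y hy
      simp only [Multiset.mem_cons] at hy
      rcases hy with rfl | rfl | h
      · exact hx
      · exact hx
      · exact hpos y (by simp [h])
    · simp; ring
    · simp
    · ring
  · rw [h2, h1, evenParts_cons_even, evenParts_cons_cons]
    refine ⟨rfl, ?_, ?_, ?_, ?_⟩
    · intro y hy
      simp only [Multiset.mem_cons] at hy
      rcases hy with rfl | h
      · omega
      · exact hpos y (by simp [h])
    · simp; ring
    · rintro ⟨h, -⟩
      have := h (2 * x) (by simp)
      rw [← Nat.not_even_iff_odd] at this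
      exact this (even_two_mul x)
    · ring

lemma finite_parts (k : ℕ) : {m : Multiset ℕ | (∀ x ∈ m, 0 < x) ∧ m.sum = k}.Finite := by
  apply (Set.finite_range (fun p : k.Partition => p.parts)).subset
  rintro m ⟨h1, h2⟩
  exact ⟨⟨m, fun {i} hi => h1 i hi, h2⟩, rfl⟩

lemma finite_FSet (n : ℕ) : (FSet n).Finite := by
  have : (⋃ k ∈ Set.Iic n, {m : Multiset ℕ | (∀ x ∈ m, 0 < x) ∧ m.sum = k}).Finite :=
    (Set.finite_Iic n).biUnion (fun k _ => finite_parts k)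
  apply (this.prod this).subset
  rintro ⟨a, b⟩ ⟨h1, h2, h3, h4⟩
  simp only at h1 h2 h3
  simp only [Set.mem_prod, Set.mem_iUnion, Set.mem_Iic, Set.mem_setOf_eq, exists_prop]
  exact ⟨⟨a.sum, by omega, h1, rfl⟩, ⟨b.sum, by omega, h2, rfl⟩⟩

lemma evenParts_add_odd (a b : Multiset ℕ) (h : ∀ x ∈ b, Odd x) :
    evenParts (a + b) = evenParts a := by
  have : b.filter (fun x => Even x) = 0 := by
    rw [Multiset.filter_eq_nil]
    intro x hx
    exact Nat.not_even_iff_odd.2 (h x hx)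
  simp [evenParts, Multiset.filter_add, this]

open Classical in
lemma signed_sum (n : ℕ) :
    ∑ p ∈ (finite_FSet n).toFinset, (-1 : ℤ) ^ evenParts (p.1 + p.2) = (QSet n).ncard := by
  have hQ : (QSet n).ncard
      = ((finite_FSet n).toFinset.filter (fun p => (∀ x ∈ p.1, Odd x) ∧ p.1.Nodup)).card := by
    rw [← Set.ncard_coe_finset]
    congr 1
    ext p
    simp [QSet]
  rw [hQ, ← Finset.sum_filter_add_sum_filter_not _
    (fun p : Multiset ℕ × Multiset ℕ => (∀ x ∈ p.1, Odd x) ∧ p.1.Nodup)]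
  have h1 : ∑ p ∈ (finite_FSet n).toFinset.filter
      (fun p => (∀ x ∈ p.1, Odd x) ∧ p.1.Nodup), (-1 : ℤ) ^ evenParts (p.1 + p.2)
      = ((finite_FSet n).toFinset.filter (fun p => (∀ x ∈ p.1, Odd x) ∧ p.1.Nodup)).card := by
    rw [Finset.card_eq_sum_ones, Nat.cast_sum]
    apply Finset.sum_congr rfl
    intro p hp
    simp only [Finset.mem_filter, Set.Finite.mem_toFinset] at hp
    have h0 : evenParts (p.1 + p.2) = 0 := by
      rw [evenParts_add_odd _ _ hp.1.2.2.2]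
      have := evenParts_add_odd 0 p.1 hp.2.1
      simpa [evenParts] using this
    rw [h0]; simp
  rw [h1, add_eq_left]
  refine Finset.sum_involution (fun p _ => (inv p.1, p.2)) ?_ ?_ ?_ ?_
  · intro p hp
    simp only [Finset.mem_filter, Set.Finite.mem_toFinset] at hp
    obtain ⟨⟨a1, a2, a3, a4⟩, hq⟩ := hp
    rw [evenParts_add_odd _ _ a4, evenParts_add_odd _ _ a4]
    exact (inv_props p.1 a1 hq).2.2.2.2
  · intro p hp _ heq
    simp only [Finset.mem_filter, Set.Finite.mem_toFinset] at hp
    obtain ⟨⟨a1, a2, a3, a4⟩, hq⟩ := hp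
    have := (inv_props p.1 a1 hq).2.2.2.2
    have h2 : inv p.1 = p.1 := congrArg Prod.fst heq
    rw [h2] at this
    have h3 : (-1 : ℤ) ^ evenParts p.1 ≠ 0 := by simp
    omega
  · intro p hp
    simp only [Finset.mem_filter, Set.Finite.mem_toFinset] at hp ⊢
    obtain ⟨⟨a1, a2, a3, a4⟩, hq⟩ := hp
    have := (inv_props p.1 a1 hq)
    exact ⟨⟨this.2.1, a2, by simp only; rw [this.2.2.1, a3], a4⟩, this.2.2.2.1⟩
  · intro p hp
    simp only [Finset.mem_filter, Set.Finite.mem_toFinset] at hp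
    obtain ⟨⟨a1, a2, a3, a4⟩, hq⟩ := hp
    have := (inv_props p.1 a1 hq)
    simp only [this.1]

open Classical in
lemma signed_sum' (n : ℕ) :
    ∑ p ∈ (finite_FSet n).toFinset, (-1 : ℤ) ^ evenParts (p.1 + p.2) = 
      (Fcount n : ℤ) - 2 * F1 n := by
  have hF : Fcount n = (finite_FSet n).toFinset.card := by
    rw [Fcount, Set.ncard_eq_toFinset_card _ (finite_FSet n)]
  have hF1 : F1 n = ((finite_FSet n).toFinset.filter
      (fun p => Odd (evenParts (p.1 + p.2)))).card := by
    rw [← Set.ncard_coe_finset, F1]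
    congr 1
    ext p
    simp
  rw [hF, hF1, Finset.card_filter, Finset.card_eq_sum_ones]
  push_cast
  rw [Finset.mul_sum, ← Finset.sum_sub_distrib]
  apply Finset.sum_congr rfl
  intro p _
  by_cases h : Odd (evenParts (p.1 + p.2))
  · simp [h, h.neg_one_pow]
  · simp [h, (Nat.not_odd_iff_even.1 h).neg_one_pow]

lemma QSet_ncard (n : ℕ) : (QSet n).ncard = pbarOdd n := by
  symm
  unfold pbarOdd
  refine Set.ncard_congr (fun p _ => (p.1.val, p.2)) ?_ ?_ ?_
  · rintro ⟨a, b⟩ ⟨⟨h1, h2, h3⟩, h4, h5⟩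
    refine ⟨⟨h1, h2, ?_, h5⟩, h4, a.nodup⟩
    simp only [Finset.sum_val] at h3 ⊢; exact h3
  · rintro ⟨a, b⟩ ⟨c, d⟩ _ _ h
    simpa using h
  · rintro ⟨a, b⟩ ⟨⟨h1, h2, h3, h5⟩, h4, h6⟩
    refine ⟨(⟨a, h6⟩, b), ⟨⟨h1, h2, ?_⟩, h4, h5⟩, rfl⟩
    simp only [← Finset.sum_val] at h3 ⊢; exact h3

def oddSet (k : ℕ) : Set (Multiset ℕ) := {m | (∀ x ∈ m, 0 < x) ∧ (∀ x ∈ m, Odd x) ∧ m.sum = k}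
def disSet (k : ℕ) : Set (Finset ℕ) := {s | (∀ x ∈ s, 0 < x) ∧ s.sum id = k}

lemma oddSet_ncard (k : ℕ) : (oddSet k).ncard = (Nat.Partition.odds k).card := by
  rw [← Set.ncard_coe_finset]
  symm
  refine Set.ncard_congr (fun p _ => p.parts) ?_ ?_ ?_
  · intro p hp
    refine ⟨fun x hx => p.parts_pos hx, fun x hx => ?_, p.parts_sum⟩
    simp [Nat.Partition.odds, Nat.Partition.restricted] at hp
    exact hp x hx
  · intro p q _ _ h
    exact Nat.Partition.ext h
  · rintro m ⟨h1, h2, h3⟩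
    refine ⟨⟨m, fun {i} hi => h1 i hi, h3⟩, ?_, rfl⟩
    simpa [Nat.Partition.odds, Nat.Partition.restricted] using h2

lemma disSet_ncard (k : ℕ) : (disSet k).ncard = (Nat.Partition.distincts k).card := by
  rw [← Set.ncard_coe_finset]
  refine Set.ncard_congr (fun s hs => ⟨s.val, fun {i} hi => hs.1 i hi, by
    rw [Finset.sum_val]; exact hs.2⟩) ?_ ?_ ?_
  · intro s hs
    simp [Nat.Partition.distincts, s.nodup]
  · intro p q _ _ h
    simpa using h
  · intro p hp
    simp [Nat.Partition.distincts] at hp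
    refine ⟨⟨p.parts, hp⟩, ⟨fun x hx => p.parts_pos hx, ?_⟩, rfl⟩
    rw [← Finset.sum_val]; exact p.parts_sum

lemma oddSet_finite (k : ℕ) : (oddSet k).Finite :=
  (finite_parts k).subset fun _ h => ⟨h.1, h.2.2⟩

lemma disSet_finite (k : ℕ) : (disSet k).Finite := by
  apply Set.Finite.of_injOn (f := fun s : Finset ℕ => s.val) (t := _) ?_ ?_ (finite_parts k)
  · intro s hs
    exact ⟨hs.1, by rw [Finset.sum_val]; exact hs.2⟩
  · intro a _ b _ h
    exact Finset.val_injective h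

lemma Fcount_eq (n : ℕ) : Fcount n = pbar n := by
  have hb : ∀ k, ∃ f : Multiset ℕ → Finset ℕ, Set.BijOn f (oddSet k) (disSet k) := by
    intro k
    apply (oddSet_finite k).exists_bijOn_of_encard_eq
    rw [← (oddSet_finite k).cast_ncard_eq, ← (disSet_finite k).cast_ncard_eq, oddSet_ncard,
      disSet_ncard, Nat.Partition.card_odds_eq_card_distincts]
  choose f hf using hb
  unfold Fcount pbar
  refine Set.ncard_congr (fun p _ => (f p.2.sum p.2, p.1)) ?_ ?_ ?_
  · rintro ⟨a, b⟩ ⟨h1, h2, h3, h4⟩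
    have := (hf b.sum).mapsTo (x := b) ⟨h2, h4, rfl⟩
    refine ⟨this.1, h1, ?_⟩
    simp only at h3 ⊢
    rw [this.2]; omega
  · rintro ⟨a, b⟩ ⟨c, d⟩ ⟨h1, h2, h3, h4⟩ ⟨h1', h2', h3', h4'⟩ h
    simp only [Prod.mk.injEq] at h h3 h3'
    obtain ⟨h, rfl⟩ := h
    have hs : d.sum = b.sum := by omega
    rw [hs] at h
    have hbd : b = d := (hf b.sum).injOn ⟨h2, h4, rfl⟩ ⟨h2', h4', hs⟩ h
    rw [hbd]
  · rintro ⟨s, a⟩ ⟨h1, h2, h3⟩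
    obtain ⟨b, ⟨hb1, hb2, hb3⟩, hb⟩ := (hf (s.sum id)).surjOn (a := s) ⟨h1, rfl⟩
    refine ⟨(a, b), ⟨h2, hb1, ?_, hb2⟩, ?_⟩
    · simp only at h3 ⊢
      omega
    · simp only [hb3, hb]

/-- `F₁(n) = (p̄(n) - p̄_o(n)) / 2`. -/
theorem F1_eq (n : ℕ) : (F1 n : ℚ) = ((pbar n : ℚ) - (pbarOdd n : ℚ)) / 2 := by
  have h := (signed_sum' n).symm.trans (signed_sum n)
  rw [QSet_ncard, Fcount_eq] at h
  have h' : (pbar n : ℚ) - 2 * F1 n = pbarOdd n := by exact_mod_cast h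
  linarith
end
end

section
/- For every nonnegative integer n, F_2(n) = (p̄(n) + (-1)^n · p̄_o(n))/2, where F_2(n) counts the partitions counted by F(n) having an even total number of parts. -/
noncomputable section

open Finset in
def prodF {α β : Type} [DecidableEq α] [DecidableEq β] (A : ℕ → Finset α) (B : ℕ → Finset β)
    (n : ℕ) : Finset (α × β) :=
  (antidiagonal n).biUnion fun ij => A ij.1 ×ˢ B ij.2

open Finset in
lemma sum_prodF {α β : Type} [DecidableEq α] [DecidableEq β] (A : ℕ → Finset α) (B : ℕ → Finset β)
    (n : ℕ) (wa : α → ℕ) (wb : β → ℕ) (hA : ∀ i, ∀ a ∈ A i, wa a = i)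
    (hB : ∀ i, ∀ a ∈ B i, wb a = i) (f : α → ℤ) (g : β → ℤ) :
    ∑ p ∈ prodF A B n, f p.1 * g p.2 =
      ∑ ij ∈ antidiagonal n, (∑ a ∈ A ij.1, f a) * (∑ b ∈ B ij.2, g b) := by
  unfold prodF
  rw [sum_biUnion]
  · refine sum_congr rfl fun ij _ => ?_
    rw [sum_product, sum_mul_sum]
  · rintro ⟨i, j⟩ _ ⟨i', j'⟩ _ hne
    rw [Function.onFun, disjoint_left]
    rintro ⟨a, b⟩ h1 h2
    simp only [mem_product] at h1 h2
    apply hne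
    rw [← hA _ _ h1.1, ← hA _ _ h2.1, ← hB _ _ h1.2, ← hB _ _ h2.2]

open Finset in
lemma card_prodF {α β : Type} [DecidableEq α] [DecidableEq β] (A : ℕ → Finset α) (B : ℕ → Finset β)
    (n : ℕ) (wa : α → ℕ) (wb : β → ℕ) (hA : ∀ i, ∀ a ∈ A i, wa a = i)
    (hB : ∀ i, ∀ a ∈ B i, wb a = i) :
    ((prodF A B n).card : ℤ) =
      ∑ ij ∈ antidiagonal n, ((A ij.1).card : ℤ) * (B ij.2).card := by
  have := sum_prodF A B n wa wb hA hB (fun _ => 1) (fun _ => 1)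
  simpa using this

def PM (n : ℕ) : Finset (Multiset ℕ) := (Finset.univ : Finset (Nat.Partition n)).image (·.parts)

lemma mem_PM {n : ℕ} {b : Multiset ℕ} : b ∈ PM n ↔ (∀ x ∈ b, 0 < x) ∧ b.sum = n := by
  simp only [PM, Finset.mem_image, Finset.mem_univ, true_and]
  constructor
  · rintro ⟨p, rfl⟩
    exact ⟨fun x hx => p.parts_pos hx, p.parts_sum⟩
  · rintro ⟨h1, h2⟩
    exact ⟨⟨b, fun {x} hx => h1 x hx, h2⟩, rfl⟩

open Classical in
def OM (n : ℕ) : Finset (Multiset ℕ) := (PM n).filter fun b => ∀ x ∈ b, Odd x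

def DM (n : ℕ) : Finset (Finset ℕ) := ((PM n).filter fun b => b.Nodup).image Multiset.toFinset

open Classical in
def DOMm (n : ℕ) : Finset (Multiset ℕ) := (PM n).filter fun b => b.Nodup ∧ ∀ x ∈ b, Odd x

def DOM (n : ℕ) : Finset (Finset ℕ) := (DOMm n).image Multiset.toFinset

lemma mem_DM {n : ℕ} {s : Finset ℕ} : s ∈ DM n ↔ (∀ x ∈ s, 0 < x) ∧ s.sum id = n := by
  simp only [DM, Finset.mem_image, Finset.mem_filter, mem_PM]
  constructor
  · rintro ⟨b, ⟨⟨h1, h2⟩, h3⟩, rfl⟩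
    refine ⟨by simpa using h1, ?_⟩
    rw [← h2, Finset.sum]
    simp [h3.dedup]
  · rintro ⟨h1, h2⟩
    refine ⟨s.val, ⟨⟨by simpa using h1, ?_⟩, s.nodup⟩, by simp⟩
    rw [← h2, Finset.sum]; simp

lemma mem_DOM {n : ℕ} {s : Finset ℕ} :
    s ∈ DOM n ↔ ((∀ x ∈ s, 0 < x) ∧ s.sum id = n) ∧ ∀ x ∈ s, Odd x := by
  rw [← mem_DM]
  simp only [DM, DOM, DOMm, Finset.mem_image, Finset.mem_filter]
  constructor
  · rintro ⟨b, ⟨h1, h2, h3⟩, rfl⟩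
    exact ⟨⟨b, ⟨h1, h2⟩, rfl⟩, by simpa using h3⟩
  · rintro ⟨⟨b, ⟨h1, h2⟩, rfl⟩, h3⟩
    exact ⟨b, ⟨h1, h2, by simpa using h3⟩, rfl⟩

lemma toFinset_injOn {S : Set (Multiset ℕ)} (h : ∀ b ∈ S, b.Nodup) :
    Set.InjOn Multiset.toFinset S := by
  intro a ha b hb hab
  have := congrArg Finset.val hab
  simpa [(h a ha).dedup, (h b hb).dedup] using this

lemma card_DOM (n : ℕ) : (DOM n).card = (DOMm n).card := by
  apply Finset.card_image_of_injOn
  apply toFinset_injOn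
  intro b hb
  simp only [DOMm, Finset.coe_filter, Set.mem_ofPred_eq] at hb
  exact hb.2.1

lemma card_DM (n : ℕ) : (DM n).card = (OM n).card := by
  have h1 : (DM n).card = ((PM n).filter fun b => b.Nodup).card := by
    apply Finset.card_image_of_injOn
    apply toFinset_injOn
    intro b hb
    simp only [Finset.coe_filter, Set.mem_ofPred_eq] at hb
    exact hb.2
  have inj : Function.Injective (fun p : Nat.Partition n => p.parts) :=
    fun p q h => Nat.Partition.ext h
  classical
  rw [h1, OM, PM, Finset.filter_image, Finset.filter_image,
    Finset.card_image_of_injective _ inj, Finset.card_image_of_injective _ inj]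
  have := Nat.Partition.card_odds_eq_card_distincts n
  simp only [Nat.Partition.odds, Nat.Partition.distincts, Nat.Partition.restricted,
    ← even_iff_two_dvd, Nat.not_even_iff_odd] at this
  rw [← this]

/-- `j` is the largest index at which one can split or merge. -/
def Cand (b : Multiset ℕ) (j : ℕ) : Prop := 1 ≤ b.count (2 * j) ∨ 2 ≤ b.count j

def TopJ (b : Multiset ℕ) (j : ℕ) : Prop := Cand b j ∧ ∀ k, j < k → ¬ Cand b k

open Classical in
def psi (j : ℕ) (b : Multiset ℕ) : Multiset ℕ :=
  if 2 * j ∈ b then j ::ₘ j ::ₘ b.erase (2 * j) else (2 * j) ::ₘ (b.erase j).erase j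

def phi (b : Multiset ℕ) : Multiset ℕ := psi (Classical.epsilon (TopJ b)) b

lemma topJ_unique {b : Multiset ℕ} {j k : ℕ} (h : TopJ b j) (h' : TopJ b k) : j = k := by
  rcases lt_trichotomy j k with h1 | h1 | h1
  · exact absurd h'.1 (h.2 _ h1)
  · exact h1
  · exact absurd h.1 (h'.2 _ h1)

lemma phi_eq {b : Multiset ℕ} {j : ℕ} (h : TopJ b j) : phi b = psi j b := by
  rw [phi, topJ_unique (Classical.epsilon_spec (p := TopJ b) ⟨j, h⟩) h]

lemma exists_top {b : Multiset ℕ} (hp : ∀ x ∈ b, 0 < x) (h : ¬ (b.Nodup ∧ ∀ x ∈ b, Odd x)) :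
    ∃ j, TopJ b j := by
  classical
  have hex : ∃ j, Cand b j := by
    by_contra hc
    push Not at hc
    apply h
    constructor
    · rw [Multiset.nodup_iff_count_le_one]
      intro a
      have := hc a
      unfold Cand at this
      omega
    · intro x hx
      rw [← Nat.not_even_iff_odd]
      rintro ⟨y, hy⟩
      apply hc y
      left
      rw [Multiset.one_le_count_iff_mem]
      rw [two_mul, ← hy]; exact hx
  obtain ⟨j0, hj0⟩ := hex
  have hb : ∀ k, Cand b k → k ≤ b.sum := by
    intro k hk
    rcases hk with hk | hk
    · have := Multiset.le_sum_of_mem (Multiset.one_le_count_iff_mem.1 hk)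
      omega
    · exact Multiset.le_sum_of_mem (Multiset.one_le_count_iff_mem.1 (by omega))
  refine ⟨Nat.findGreatest (Cand b) b.sum, Nat.findGreatest_spec (hb _ hj0) hj0, ?_⟩
  intro k hk hc
  exact absurd (Nat.le_findGreatest (hb _ hc) hc) (by omega)

lemma topJ_pos {b : Multiset ℕ} {j : ℕ} (hp : ∀ x ∈ b, 0 < x) (h : TopJ b j) : 0 < j := by
  rcases h.1 with hk | hk
  · have := hp _ (Multiset.one_le_count_iff_mem.1 hk)
    omega
  · exact hp _ (Multiset.one_le_count_iff_mem.1 (by omega))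

lemma merge_decomp {b : Multiset ℕ} {j : ℕ} (hc : 2 ≤ b.count j) :
    ∃ c, b = j ::ₘ j ::ₘ c := by
  have h1 : Multiset.replicate 2 j ≤ b := Multiset.le_count_iff_replicate_le.1 hc
  obtain ⟨c, rfl⟩ := Multiset.le_iff_exists_add.1 h1
  exact ⟨c, by simp [Multiset.replicate_succ]⟩

/-- Either split or merge, described on a common remainder. -/
lemma psi_cases {b : Multiset ℕ} {j : ℕ} (hj : 0 < j) (h : TopJ b j) :
    ∃ c : Multiset ℕ, 2 * j ∉ c ∧
      ((b = (2 * j) ::ₘ c ∧ psi j b = j ::ₘ j ::ₘ c) ∨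
       (b = j ::ₘ j ::ₘ c ∧ psi j b = (2 * j) ::ₘ c)) := by
  by_cases hm : 2 * j ∈ b
  · obtain ⟨c, rfl⟩ := Multiset.exists_cons_of_mem hm
    refine ⟨c, ?_, Or.inl ⟨rfl, by simp [psi]⟩⟩
    intro hc
    have := h.2 (2 * j) (by omega)
    apply this
    right
    have := Multiset.one_le_count_iff_mem.2 hc
    simp; omega
  · have h2 : 2 ≤ b.count j := by
      rcases h.1 with h1 | h1
      · exact absurd (Multiset.one_le_count_iff_mem.1 h1) hm
      · exact h1
    obtain ⟨c, rfl⟩ := merge_decomp h2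
    refine ⟨c, ?_, Or.inr ⟨rfl, by rw [psi, if_neg hm]; simp⟩⟩
    intro hc
    exact hm (by simp [hc])

lemma psi_split {c : Multiset ℕ} {j : ℕ} : psi j ((2 * j) ::ₘ c) = j ::ₘ j ::ₘ c := by
  simp [psi]

lemma psi_merge {c : Multiset ℕ} {j : ℕ} (hj : 0 < j) (hc : 2 * j ∉ c) :
    psi j (j ::ₘ j ::ₘ c) = (2 * j) ::ₘ c := by
  rw [psi, if_neg]
  · simp
  · simp [hc]; omega

lemma top_psi {b : Multiset ℕ} {j : ℕ} (hj : 0 < j) (h : TopJ b j) : TopJ (psi j b) j := by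
  obtain ⟨c, hc, ⟨rfl, h2⟩ | ⟨rfl, h2⟩⟩ := psi_cases hj h
  · rw [h2]
    refine ⟨Or.inr (by simp), fun k hk hcand => h.2 k hk ?_⟩
    unfold Cand at *
    simp only [Multiset.count_cons] at *
    split_ifs at * <;> omega
  · rw [h2]
    refine ⟨Or.inl (by simp), fun k hk hcand => h.2 k hk ?_⟩
    have := Multiset.count_eq_zero.2 hc
    unfold Cand at *
    simp only [Multiset.count_cons] at *
    rcases eq_or_ne k (2 * j) with rfl | hne
    · split_ifs at * <;> omega
    · split_ifs at * <;> omega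

lemma sum_PM (n : ℕ) : ∑ b ∈ PM n, (-1 : ℤ) ^ (Multiset.card b) =
    ∑ b ∈ DOMm n, (-1 : ℤ) ^ (Multiset.card b) := by
  classical
  rw [DOMm, ← Finset.sum_filter_add_sum_filter_not (PM n) (fun b => b.Nodup ∧ ∀ x ∈ b, Odd x)]
  rw [add_eq_left]
  have key : ∀ b ∈ (PM n).filter (fun b => ¬ (b.Nodup ∧ ∀ x ∈ b, Odd x)),
      ∃ j, 0 < j ∧ TopJ b j := by
    intro b hb
    rw [Finset.mem_filter, mem_PM] at hb
    obtain ⟨j, hj⟩ := exists_top hb.1.1 hb.2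
    exact ⟨j, topJ_pos hb.1.1 hj, hj⟩
  refine Finset.sum_involution (fun b _ => phi b) ?_ ?_ ?_ ?_
  · intro b hb
    obtain ⟨j, hj, ht⟩ := key b hb
    simp only [phi_eq ht]
    obtain ⟨c, hc, ⟨h1, h2⟩ | ⟨h1, h2⟩⟩ := psi_cases hj ht
    · rw [h2, h1]; simp [pow_succ]
    · rw [h2, h1]; simp [pow_succ]
  · intro b hb _ heq
    obtain ⟨j, hj, ht⟩ := key b hb
    simp only [phi_eq ht] at heq
    have heq := congrArg Multiset.card heq
    obtain ⟨c, hc, ⟨h1, h2⟩ | ⟨h1, h2⟩⟩ := psi_cases hj ht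
    · rw [h2, h1] at heq; simp at heq
    · rw [h2, h1] at heq; simp at heq
  · intro b hb
    obtain ⟨j, hj, ht⟩ := key b hb
    simp only [phi_eq ht]
    have ht' := top_psi hj ht
    rw [Finset.mem_filter, mem_PM] at hb ⊢
    constructor
    · obtain ⟨c, hc, ⟨h1, h2⟩ | ⟨h1, h2⟩⟩ := psi_cases hj ht
      · rw [h2]
        rw [h1] at hb
        simp only [Multiset.mem_cons, Multiset.sum_cons, forall_eq_or_imp] at hb ⊢
        exact ⟨⟨hj, hj, hb.1.1.2⟩, by omega⟩
      · rw [h2]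
        rw [h1] at hb
        simp only [Multiset.mem_cons, Multiset.sum_cons, forall_eq_or_imp] at hb ⊢
        exact ⟨⟨by omega, hb.1.1.2.2⟩, by omega⟩
    · rintro ⟨hn, ho⟩
      rcases ht'.1 with h | h
      · have := ho _ (Multiset.one_le_count_iff_mem.1 h)
        rw [← Nat.not_even_iff_odd] at this
        exact this (even_two_mul j)
      · have := Multiset.nodup_iff_count_le_one.1 hn j
        omega
  · intro b hb
    obtain ⟨j, hj, ht⟩ := key b hb
    simp only [phi_eq ht, phi_eq (top_psi hj ht)]
    obtain ⟨c, hc, ⟨h1, h2⟩ | ⟨h1, h2⟩⟩ := psi_cases hj ht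
    · rw [h2, psi_merge hj hc, h1]
    · rw [h2, psi_split, h1]

lemma neg_one_pow_card {b : Multiset ℕ} (h : ∀ x ∈ b, Odd x) :
    (-1 : ℤ) ^ (Multiset.card b) = (-1) ^ b.sum := by
  induction b using Multiset.induction_on with
  | empty => simp
  | cons a s ih =>
    simp only [Multiset.mem_cons, forall_eq_or_imp] at h
    rw [Multiset.card_cons, Multiset.sum_cons, pow_succ, pow_add, ih h.2, h.1.neg_one_pow]
    ring

lemma sum_OM (n : ℕ) : ∑ b ∈ OM n, (-1 : ℤ) ^ (Multiset.card b) = (-1) ^ n * (OM n).card := by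
  rw [Finset.sum_congr rfl (g := fun _ => (-1 : ℤ) ^ n)]
  · simp [mul_comm]
  · intro b hb
    rw [OM, Finset.mem_filter, mem_PM] at hb
    rw [neg_one_pow_card hb.2, hb.1.2]

lemma sum_DOMm (n : ℕ) :
    ∑ b ∈ DOMm n, (-1 : ℤ) ^ (Multiset.card b) = (-1) ^ n * (DOM n).card := by
  rw [card_DOM, Finset.sum_congr rfl (g := fun _ => (-1 : ℤ) ^ n)]
  · simp [mul_comm]
  · intro b hb
    rw [DOMm, Finset.mem_filter, mem_PM] at hb
    rw [neg_one_pow_card hb.2.2, hb.1.2]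

lemma wPM : ∀ i, ∀ a ∈ PM i, a.sum = i := fun _ _ h => (mem_PM.1 h).2
lemma wOM : ∀ i, ∀ a ∈ OM i, a.sum = i := fun i a h => by
  rw [OM, Finset.mem_filter] at h
  exact wPM i a h.1
lemma wDM : ∀ i, ∀ a ∈ DM i, a.sum id = i := fun _ _ h => (mem_DM.1 h).2
lemma wDOM : ∀ i, ∀ a ∈ DOM i, a.sum id = i := fun _ _ h => (mem_DOM.1 h).1.2

lemma FSet_eq (n : ℕ) : FSet n = ↑(prodF PM OM n) := by
  ext ⟨b, g⟩
  simp only [FSet, prodF, OM, Finset.coe_biUnion, Set.mem_iUnion, Finset.mem_coe, Prod.exists,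
    Finset.HasAntidiagonal.mem_antidiagonal, Finset.mem_product, Finset.mem_filter, mem_PM, Set.mem_ofPred_eq]
  constructor
  · rintro ⟨h1, h2, h3, h4⟩
    exact ⟨_, _, h3, ⟨h1, rfl⟩, ⟨h2, rfl⟩, h4⟩
  · rintro ⟨i, j, h, ⟨h1, rfl⟩, ⟨h2, rfl⟩, h3⟩
    exact ⟨h1, h2, h, h3⟩

lemma over_eq (n : ℕ) : overpartitions n = ↑(prodF DM PM n) := by
  ext ⟨b, g⟩
  simp only [overpartitions, prodF, Finset.coe_biUnion, Set.mem_iUnion, Finset.mem_coe, Prod.exists,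
    Finset.HasAntidiagonal.mem_antidiagonal, Finset.mem_product, mem_PM, mem_DM, Set.mem_ofPred_eq]
  constructor
  · rintro ⟨h1, h2, h3⟩
    exact ⟨_, _, h3, ⟨h1, rfl⟩, ⟨h2, rfl⟩⟩
  · rintro ⟨i, j, h, ⟨h1, rfl⟩, ⟨h2, rfl⟩⟩
    exact ⟨h1, h2, h⟩

lemma overOdd_eq (n : ℕ) : overpartitionsOdd n = ↑(prodF DOM OM n) := by
  ext ⟨b, g⟩
  simp only [overpartitionsOdd, overpartitions, prodF, OM, Finset.coe_biUnion, Set.mem_iUnion,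
    Finset.mem_coe, Prod.exists, Finset.mem_filter,
    Finset.HasAntidiagonal.mem_antidiagonal, Finset.mem_product, mem_PM, mem_DOM, Set.mem_ofPred_eq]
  constructor
  · rintro ⟨⟨h1, h2, h3⟩, h4, h5⟩
    exact ⟨_, _, h3, ⟨⟨h1, rfl⟩, h4⟩, ⟨h2, rfl⟩, h5⟩
  · rintro ⟨i, j, h, ⟨⟨h1, rfl⟩, h4⟩, ⟨h2, rfl⟩, h5⟩
    exact ⟨⟨h1, h2, h⟩, h4, h5⟩

lemma two_F2 (n : ℕ) : 2 * (F2 n : ℤ) = (prodF PM OM n).card +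
    ∑ p ∈ prodF PM OM n, (-1 : ℤ) ^ (Multiset.card p.1) * (-1 : ℤ) ^ (Multiset.card p.2) := by
  classical
  have h : {p ∈ FSet n | Even (Multiset.card (p.1 + p.2))} =
      ↑((prodF PM OM n).filter fun p => Even (Multiset.card (p.1 + p.2))) := by
    ext p
    simp [FSet_eq]
  rw [F2, h, Set.ncard_coe_finset, Finset.card_filter, Finset.card_eq_sum_ones]
  push_cast
  rw [Finset.mul_sum, ← Finset.sum_add_distrib]
  refine Finset.sum_congr rfl fun p _ => ?_
  rw [← pow_add, ← Multiset.card_add]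
  split_ifs with he
  · rw [he.neg_one_pow]; norm_num
  · rw [(Nat.not_even_iff_odd.1 he).neg_one_pow]; norm_num

/-- `F₂(n) = (p̄(n) + (-1)^n * p̄_o(n)) / 2`. -/
theorem F2_eq (n : ℕ) : (F2 n : ℚ) = ((pbar n : ℚ) + (-1) ^ n * (pbarOdd n : ℚ)) / 2 := by
  have e1 : ((prodF PM OM n).card : ℤ) = (pbar n : ℤ) := by
    rw [pbar, over_eq, Set.ncard_coe_finset, card_prodF DM PM n _ _ wDM wPM,
      card_prodF PM OM n _ _ wPM wOM, ← Finset.Nat.sum_antidiagonal_swap]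
    refine Finset.sum_congr rfl fun ij _ => ?_
    rw [card_DM, mul_comm, Prod.fst_swap, Prod.snd_swap]
  have e2 : ∑ p ∈ prodF PM OM n, (-1 : ℤ) ^ (Multiset.card p.1) * (-1 : ℤ) ^ (Multiset.card p.2)
      = (-1) ^ n * (pbarOdd n : ℤ) := by
    rw [pbarOdd, overOdd_eq, Set.ncard_coe_finset, card_prodF DOM OM n _ _ wDOM wOM,
      sum_prodF PM OM n _ _ wPM wOM (fun b => (-1 : ℤ) ^ (Multiset.card b))
        (fun b => (-1 : ℤ) ^ (Multiset.card b)), Finset.mul_sum]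
    refine Finset.sum_congr rfl fun ij hij => ?_
    rw [sum_PM, sum_DOMm, sum_OM, ← Finset.HasAntidiagonal.mem_antidiagonal.1 hij, pow_add]
    ring
  have key : 2 * (F2 n : ℤ) = (pbar n : ℤ) + (-1) ^ n * (pbarOdd n : ℤ) := by
    rw [two_F2, e1, e2]
  have key' : 2 * (F2 n : ℚ) = (pbar n : ℚ) + (-1) ^ n * (pbarOdd n : ℚ) := by exact_mod_cast key
  linarith
end
end

section
/- For every nonnegative integer n, G_1(n) = (G(n) - H(n))/2, where G_1(n) counts the partitions counted by G(n) having an odd number of blue even parts. -/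
noncomputable section

def PP (m : Multiset ℕ) (a : ℕ) : Prop := 2 * a ∈ m ∨ 2 ≤ m.count a

def IsM (m : Multiset ℕ) (a : ℕ) : Prop := PP m a ∧ ∀ b, a < b → ¬ PP m b

open Classical in
def invo (m : Multiset ℕ) : Multiset ℕ :=
  let a := Nat.findGreatest (PP m) m.sum
  if 2 * a ∈ m then a ::ₘ a ::ₘ m.erase (2 * a) else (2 * a) ::ₘ (m.erase a).erase a

lemma PP_le {m : Multiset ℕ} {a : ℕ} (h : PP m a) : a ≤ m.sum := by
  rcases h with h | h
  · have := Multiset.le_sum_of_mem h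
    omega
  · have : a ∈ m := by
      rw [← Multiset.count_pos]; omega
    exact Multiset.le_sum_of_mem this

lemma IsM_find {m : Multiset ℕ} {a : ℕ} (h : IsM m a) [DecidablePred (PP m)] :
    Nat.findGreatest (PP m) m.sum = a := by
  rw [Nat.findGreatest_eq_iff]
  exact ⟨PP_le h.1, fun _ => h.1, fun k hk _ => h.2 k hk⟩

lemma exists_IsM {m : Multiset ℕ} (h : ∃ a, PP m a) : ∃ a, IsM m a := by
  classical
  obtain ⟨b, hb⟩ := h
  refine ⟨Nat.findGreatest (PP m) m.sum, Nat.findGreatest_spec (PP_le hb) hb, ?_⟩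
  intro c hc hP
  have := Nat.le_findGreatest (PP_le hP) hP
  omega

lemma step1 {m : Multiset ℕ} {a : ℕ} (ha : 0 < a) (h : IsM ((2 * a) ::ₘ m) a) :
    2 * a ∉ m ∧ IsM (a ::ₘ a ::ₘ m) a := by
  obtain ⟨h1, h2⟩ := h
  have h3 : 2 * a ∉ m := by
    intro hm
    apply h2 (2 * a) (by omega)
    right
    have := Multiset.count_pos.2 hm
    simp; omega
  refine ⟨h3, Or.inr (by simp), ?_⟩
  intro b hb hP
  apply h2 b hb
  rcases hP with hP | hP
  · left
    simp only [Multiset.mem_cons] at hP ⊢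
    rcases hP with hP | hP | hP
    · omega
    · omega
    · exact Or.inr hP
  · right
    rw [Multiset.count_cons_of_ne (by omega), Multiset.count_cons_of_ne (by omega)] at hP
    exact hP.trans (Multiset.count_le_count_cons _ _ _)

lemma step2 {m : Multiset ℕ} {a : ℕ} (_ : 0 < a) (h : IsM (a ::ₘ a ::ₘ m) a)
    (h3 : 2 * a ∉ m) : IsM ((2 * a) ::ₘ m) a := by
  obtain ⟨h1, h2⟩ := h
  refine ⟨Or.inl (by simp), ?_⟩
  intro b hb hP
  apply h2 b hb
  rcases hP with hP | hP
  · left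
    simp only [Multiset.mem_cons] at hP ⊢
    rcases hP with hP | hP
    · omega
    · exact Or.inr (Or.inr hP)
  · right
    by_cases hba : b = 2 * a
    · subst hba
      rw [Multiset.count_cons_self, Multiset.count_eq_zero_of_notMem h3] at hP
      omega
    · rw [Multiset.count_cons_of_ne hba] at hP
      exact hP.trans ((Multiset.count_le_count_cons _ _ _).trans
        (Multiset.count_le_count_cons _ _ _))

lemma invo1 {m : Multiset ℕ} {a : ℕ} (h : IsM ((2 * a) ::ₘ m) a) :
    invo ((2 * a) ::ₘ m) = a ::ₘ a ::ₘ m := by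
  classical
  unfold invo
  simp only [IsM_find h]
  simp

lemma invo2 {m : Multiset ℕ} {a : ℕ} (ha : 0 < a) (h : IsM (a ::ₘ a ::ₘ m) a)
    (h3 : 2 * a ∉ m) : invo (a ::ₘ a ::ₘ m) = (2 * a) ::ₘ m := by
  classical
  unfold invo
  simp only [IsM_find h]
  rw [if_neg]
  · simp
  · simp only [Multiset.mem_cons]
    rintro (h | h | h)
    · omega
    · omega
    · exact h3 h

lemma decomp {m : Multiset ℕ} (hpos : ∀ x ∈ m, 0 < x) (h : ∃ a, PP m a) :
    ∃ a k, 0 < a ∧ 2 * a ∉ k ∧ IsM ((2 * a) ::ₘ k) a ∧ IsM (a ::ₘ a ::ₘ k) a ∧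
      (m = (2 * a) ::ₘ k ∨ m = a ::ₘ a ::ₘ k) := by
  obtain ⟨a, ha⟩ := exists_IsM h
  have ha0 : 0 < a := by
    rcases ha.1 with h | h
    · have := hpos _ h; omega
    · exact hpos _ (by rw [← Multiset.count_pos]; omega)
  by_cases hm : 2 * a ∈ m
  · obtain ⟨k, rfl⟩ := Multiset.exists_cons_of_mem hm
    obtain ⟨h1, h2⟩ := step1 ha0 ha
    exact ⟨a, k, ha0, h1, ha, h2, Or.inl rfl⟩
  · have hc : 2 ≤ m.count a := ha.1.resolve_left hm
    obtain ⟨k, rfl⟩ := Multiset.exists_cons_of_mem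
      (show a ∈ m by rw [← Multiset.count_pos]; omega)
    rw [Multiset.count_cons_self] at hc
    obtain ⟨k, rfl⟩ := Multiset.exists_cons_of_mem
      (show a ∈ k by rw [← Multiset.count_pos]; omega)
    have h1 : 2 * a ∉ k := fun h => hm (by simp [h])
    exact ⟨a, k, ha0, h1, step2 ha0 ha h1, ha, Or.inr rfl⟩

lemma evenParts_cons (a : ℕ) (m : Multiset ℕ) :
    evenParts (a ::ₘ m) = evenParts m + if Even a then 1 else 0 := by
  unfold evenParts
  by_cases h : Even a <;> simp [h]

lemma invo_props {m : Multiset ℕ} (hpos : ∀ x ∈ m, 0 < x) (h : ∃ a, PP m a) :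
    (∀ x ∈ invo m, 0 < x) ∧ (∃ a, PP (invo m) a) ∧ (invo m).sum = m.sum ∧
    (Odd (evenParts (invo m)) ↔ Even (evenParts m)) ∧ invo (invo m) = m := by
  obtain ⟨a, k, ha, hk, h1, h2, rfl | rfl⟩ := decomp hpos h
  · rw [invo1 h1, invo2 ha h2 hk]
    refine ⟨?_, ⟨a, h2.1⟩, ?_, ?_, rfl⟩
    · intro x hx
      simp only [Multiset.mem_cons] at hx
      rcases hx with rfl | rfl | hx
      · exact ha
      · exact ha
      · exact hpos x (by simp [hx])
    · simp; ring
    · simp only [evenParts_cons]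
      split_ifs <;> grind
  · rw [invo2 ha h2 hk, invo1 h1]
    refine ⟨?_, ⟨a, h1.1⟩, ?_, ?_, rfl⟩
    · intro x hx
      simp only [Multiset.mem_cons] at hx
      rcases hx with rfl | hx
      · omega
      · exact hpos x (by simp [hx])
    · simp; ring
    · simp only [evenParts_cons]
      split_ifs <;> grind

lemma not_PP_iff (m : Multiset ℕ) : (¬ ∃ a, PP m a) ↔ (∀ x ∈ m, Odd x) ∧ m.Nodup := by
  rw [Multiset.nodup_iff_count_le_one]
  constructor
  · intro h
    refine ⟨fun x hx => ?_, fun x => ?_⟩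
    · by_contra hx2
      rw [Nat.not_odd_iff_even] at hx2
      obtain ⟨b, rfl⟩ := hx2
      exact h ⟨b, Or.inl (by rwa [two_mul])⟩
    · by_contra hx
      exact h ⟨x, Or.inr (by omega)⟩
  · rintro ⟨h1, h2⟩ ⟨a, h | h⟩
    · have := h1 _ h
      grind
    · have := h2 a
      omega

lemma GSet_finite (n : ℕ) : (GSet n).Finite := by
  have hf : {m : Multiset ℕ | (∀ x ∈ m, 0 < x) ∧ m.sum ≤ n}.Finite := by
    refine Set.Finite.subset (s := ⋃ k ∈ Set.Iic n,
      Set.range (fun p : Nat.Partition k => p.parts)) ?_ ?_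
    · exact (Set.finite_Iic n).biUnion fun k _ => Set.finite_range _
    · rintro m ⟨h1, h2⟩
      simp only [Set.mem_iUnion]
      exact ⟨m.sum, h2, ⟨m, fun {x} hx => h1 x hx, rfl⟩, rfl⟩
  refine (hf.prod hf).subset ?_
  rintro ⟨p, q⟩ ⟨h1, h2, h3, h4⟩
  simp only at h1 h2 h3
  exact ⟨⟨h1, by simp only; omega⟩, ⟨h2, by simp only; omega⟩⟩

lemma R_eq_H (n : ℕ) : Rcount n = Hcount n := by
  unfold Rcount Hcount
  have key : Set.InvOn (fun m : Multiset ℕ => (m.filter (fun x => Odd x),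
      m.filter (fun x => ¬ Odd x))) (fun p : Multiset ℕ × Multiset ℕ => p.1 + p.2)
      (RSet n) (HSet n) := by
    constructor
    · rintro ⟨p, q⟩ ⟨⟨h1, h2, h3, h4⟩, h5, h6⟩
      simp only at h1 h2 h3 h4 h5 h6
      have e1 : p.filter (fun x => Odd x) = p := Multiset.filter_eq_self.2 h5
      have e2 : q.filter (fun x => Odd x) = 0 :=
        Multiset.filter_eq_nil.2 fun x hx => by simpa using h4 x hx
      have e3 : p.filter (fun x => ¬ Odd x) = 0 :=
        Multiset.filter_eq_nil.2 fun x hx => by simpa using h5 x hx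
      have e4 : q.filter (fun x => ¬ Odd x) = q :=
        Multiset.filter_eq_self.2 fun x hx => by simpa using h4 x hx
      simp only [Multiset.filter_add, e1, e2, e3, e4, add_zero, zero_add]
    · intro m _
      exact Multiset.filter_add_not _ m
  refine (key.bijOn ?_ ?_).ncard_eq
  · rintro ⟨p, q⟩ ⟨⟨h1, h2, h3, h4⟩, h5, h6⟩
    simp only at h1 h2 h3 h4 h5 h6
    refine ⟨?_, ?_, ?_⟩
    · intro x hx
      rcases Multiset.mem_add.1 hx with hx | hx
      · exact h1 x hx
      · exact h2 x hx
    · simpa using h3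
    · have e1 : p.filter (fun x => Odd x) = p := Multiset.filter_eq_self.2 h5
      have e2 : q.filter (fun x => Odd x) = 0 :=
        Multiset.filter_eq_nil.2 fun x hx => by simpa using h4 x hx
      simp only [Multiset.filter_add, e1, e2, add_zero]
      exact h6
  · rintro m ⟨h1, h2, h3⟩
    refine ⟨⟨?_, ?_, ?_, ?_⟩, ?_, h3⟩
    · exact fun x hx => h1 x (Multiset.mem_of_mem_filter hx)
    · exact fun x hx => h1 x (Multiset.mem_of_mem_filter hx)
    · simp only
      rw [← Multiset.sum_add, Multiset.filter_add_not, h2]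
    · intro x hx
      simpa using (Multiset.mem_filter.1 hx).2
    · exact fun x hx => (Multiset.mem_filter.1 hx).2

lemma PP_of_odd {m : Multiset ℕ} (h : Odd (evenParts m)) : ∃ a, PP m a := by
  by_contra hc
  have h1 := ((not_PP_iff m).1 hc).1
  have : evenParts m = 0 := by
    unfold evenParts
    rw [Multiset.card_eq_zero]
    exact Multiset.filter_eq_nil.2 fun x hx => by simpa using h1 x hx
  rw [this] at h
  simp at h

lemma GSet_invo {n : ℕ} {p : Multiset ℕ × Multiset ℕ} (hp : p ∈ GSet n) (h : ∃ a, PP p.1 a) :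
    (invo p.1, p.2) ∈ GSet n := by
  obtain ⟨h1, h2, h3, h4⟩ := hp
  obtain ⟨g1, g2, g3, g4, g5⟩ := invo_props h1 h
  exact ⟨g1, h2, by simp only [g3]; exact h3, h4⟩

lemma G1_eq_G0' (n : ℕ) :
    G1 n = {p ∈ GSet n | Even (evenParts p.1) ∧ ∃ a, PP p.1 a}.ncard := by
  unfold G1
  have key : Set.InvOn (fun p : Multiset ℕ × Multiset ℕ => (invo p.1, p.2))
      (fun p : Multiset ℕ × Multiset ℕ => (invo p.1, p.2))
      {p ∈ GSet n | Odd (evenParts p.1)}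
      {p ∈ GSet n | Even (evenParts p.1) ∧ ∃ a, PP p.1 a} := by
    constructor
    · rintro ⟨p, q⟩ ⟨hG, h⟩
      simp only [(invo_props hG.1 (PP_of_odd h)).2.2.2.2]
    · rintro ⟨p, q⟩ ⟨hG, _, h⟩
      simp only [(invo_props hG.1 h).2.2.2.2]
  refine (key.bijOn ?_ ?_).ncard_eq
  · rintro ⟨p, q⟩ ⟨hG, h⟩
    have hP := PP_of_odd h
    refine ⟨GSet_invo hG hP, ?_, (invo_props hG.1 hP).2.1⟩
    rw [← Nat.not_odd_iff_even, (invo_props hG.1 hP).2.2.2.1, Nat.not_even_iff_odd]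
    exact h
  · rintro ⟨p, q⟩ ⟨hG, h, hP⟩
    exact ⟨GSet_invo hG hP, (invo_props hG.1 hP).2.2.2.1.2 h⟩

/-- `G₁(n) = (G(n) - H(n)) / 2`. -/
theorem G1_eq (n : ℕ) : (G1 n : ℚ) = ((Gcount n : ℚ) - (Hcount n : ℚ)) / 2 := by
  have hfin := GSet_finite n
  have e1 : GSet n = {p ∈ GSet n | ∃ a, PP p.1 a} ∪ RSet n := by
    ext p
    have := not_PP_iff p.1
    simp only [Set.mem_union, Set.mem_setOf_eq, RSet]
    tauto
  have e2 : {p ∈ GSet n | ∃ a, PP p.1 a} = {p ∈ GSet n | Odd (evenParts p.1)} ∪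
      {p ∈ GSet n | Even (evenParts p.1) ∧ ∃ a, PP p.1 a} := by
    ext p
    have h1 := @PP_of_odd p.1
    have h2 := Nat.even_or_odd (evenParts p.1)
    simp only [Set.mem_union, Set.mem_setOf_eq]
    tauto
  have c1 : Gcount n = {p ∈ GSet n | ∃ a, PP p.1 a}.ncard + Rcount n := by
    unfold Gcount Rcount
    conv_lhs => rw [e1]
    refine Set.ncard_union_eq ?_ (hfin.subset fun p hp => hp.1) (hfin.subset fun p hp => hp.1)
    rw [Set.disjoint_left]
    rintro p ⟨_, h⟩ ⟨_, h'⟩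
    exact (not_PP_iff p.1).2 h' h
  have c2 : {p ∈ GSet n | ∃ a, PP p.1 a}.ncard = G1 n + G1 n := by
    rw [e2, Set.ncard_union_eq ?_ (hfin.subset fun p hp => hp.1) (hfin.subset fun p hp => hp.1),
      ← G1_eq_G0']
    · rfl
    · rw [Set.disjoint_left]
      rintro p ⟨_, h⟩ ⟨_, h', _⟩
      exact (Nat.not_even_iff_odd.2 h) h'
  rw [c2, R_eq_H] at c1
  rw [c1]
  push_cast
  ring
end
end
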